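/- Let p be an odd prime and let g ∈ ℤ_p^× be a topological generator of ℤ_p^×. If i is a natural number with p − 1 dividing i + 1, then the p-adic valuation of 1 − g^{i+1} equals 1 + ν_p(i+1), where ν_p denotes the p-adic valuation. If p − 1 does not divide i + 1, then the p-adic valuation of 1 − g^{i+1} equals 0. -/

import Mathlib

lemma aux_surj (p : ℕ) [Fact p.Prime] (g : ℤ_[p]ˣ)
    (hg : (Subgroup.zpowers g).topologicalClosure = ⊤) (n : ℕ) (u : ℤ_[p]ˣ) :
    ∃ k : ℤ, Units.map (PadicInt.toZModPow n : ℤ_[p] →+* ZMod (p ^ n)).toMonoidHom (g ^ k) =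
      Units.map (PadicInt.toZModPow n : ℤ_[p] →+* ZMod (p ^ n)).toMonoidHom u := by
  have hu : u ∈ closure ((Subgroup.zpowers g : Subgroup ℤ_[p]ˣ) : Set ℤ_[p]ˣ) := by
    rw [← Subgroup.topologicalClosure_coe, hg]; trivial
  have hp0 : (0 : ℝ) < (p : ℝ) := by exact_mod_cast (Fact.out : p.Prime).pos
  rw [mem_closure_iff] at hu
  obtain ⟨v, hv, ⟨k, rfl⟩⟩ := hu (Units.val ⁻¹' Metric.ball (u : ℤ_[p]) ((p : ℝ) ^ (-n : ℤ)))
    (Metric.isOpen_ball.preimage Units.continuous_val)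
    (by simpa using zpow_pos hp0 (-n : ℤ))
  refine ⟨k, ?_⟩
  ext
  rw [Set.mem_preimage, Metric.mem_ball, dist_eq_norm] at hv
  have h1 := (PadicInt.norm_le_pow_iff_mem_span_pow _ n).1 hv.le
  rw [← PadicInt.ker_toZModPow, RingHom.mem_ker, map_sub, sub_eq_zero] at h1
  exact h1

lemma aux_units_surj (p : ℕ) [Fact p.Prime] (n : ℕ) (hn : n ≠ 0) :
    Function.Surjective
      (Units.map (PadicInt.toZModPow n : ℤ_[p] →+* ZMod (p ^ n)).toMonoidHom) := by
  have : Fact (1 < p ^ n) := ⟨Nat.one_lt_pow hn (Fact.out : p.Prime).one_lt⟩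
  have hs : Function.Surjective (PadicInt.toZModPow n : ℤ_[p] →+* ZMod (p ^ n)) :=
    ZMod.ringHom_surjective _
  have := IsLocalRing.surjective_units_map_of_local_ringHom
    (PadicInt.toZModPow n : ℤ_[p] →+* ZMod (p ^ n)) hs inferInstance
  exact this

lemma aux_dvd_iff (p : ℕ) [Fact p.Prime] (g : ℤ_[p]ˣ)
    (hg : (Subgroup.zpowers g).topologicalClosure = ⊤) (n m : ℕ) :
    (1 : ℤ_[p]) - (g : ℤ_[p]) ^ m ∈ (Ideal.span {(p : ℤ_[p]) ^ (n + 1)} : Ideal ℤ_[p]) ↔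
      p ^ n * (p - 1) ∣ m := by
  set f := Units.map (PadicInt.toZModPow (n + 1) : ℤ_[p] →+* ZMod (p ^ (n + 1))).toMonoidHom
    with hf
  have : NeZero (p ^ (n + 1)) := ⟨pow_ne_zero _ (Fact.out : p.Prime).ne_zero⟩
  have ho : orderOf (f g) = p ^ n * (p - 1) := by
    rw [orderOf_eq_card_of_forall_mem_zpowers, Nat.card_eq_fintype_card,
      ZMod.card_units_eq_totient, Nat.totient_prime_pow_succ Fact.out]
    intro x
    obtain ⟨u, rfl⟩ := aux_units_surj p (n + 1) n.succ_ne_zero x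
    obtain ⟨k, hk⟩ := aux_surj p g hg (n + 1) u
    exact ⟨k, by rw [← hk]; simp [hf]⟩
  rw [← ho, orderOf_dvd_iff_pow_eq_one, ← PadicInt.ker_toZModPow, RingHom.mem_ker, map_sub,
    sub_eq_zero, ← map_pow, Units.ext_iff, eq_comm, map_one]
  simp [hf]

/-- Let `p` be an odd prime and `g` a topological generator of `ℤ_p^×`.
If `p - 1 ∣ i + 1` then the `p`-adic valuation of `1 - g^(i+1)` equals `1 + ν_p(i+1)`,
and if `p - 1` does not divide `i + 1` then this valuation is `0`. -/
theorem valuation_one_sub_pow (p : ℕ) [Fact p.Prime] (hp : Odd p) (g : ℤ_[p]ˣ)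
    (hg : (Subgroup.zpowers g).topologicalClosure = ⊤) (i : ℕ) :
    ((p - 1 ∣ i + 1) →
      ((1 : ℤ_[p]) - (g : ℤ_[p]) ^ (i + 1)).valuation = 1 + (padicValNat p (i + 1) : ℤ)) ∧
    (¬ (p - 1 ∣ i + 1) →
      ((1 : ℤ_[p]) - (g : ℤ_[p]) ^ (i + 1)).valuation = 0) := by
  have hpp : p.Prime := Fact.out
  have key := fun n => aux_dvd_iff p g hg n (i + 1)
  set x := (1 : ℤ_[p]) - (g : ℤ_[p]) ^ (i + 1) with hx
  have hx0 : x ≠ 0 := by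
    intro h0
    have h1 := (key (i + 1)).1 (by rw [h0]; exact zero_mem _)
    have h2 := Nat.le_of_dvd (by omega) ((Dvd.intro _ rfl).trans h1)
    have h3 := Nat.lt_pow_self hpp.one_lt (n := i + 1)
    omega
  have key2 : ∀ n, n + 1 ≤ x.valuation ↔ p ^ n * (p - 1) ∣ i + 1 := fun n => by
    rw [← key n, PadicInt.mem_span_pow_iff_le_valuation x hx0]
  constructor
  · intro hd
    have key3 : ∀ n, n + 1 ≤ x.valuation ↔ n ≤ padicValNat p (i + 1) := fun n => by
      rw [key2 n, ← padicValNat_dvd_iff_le (by omega)]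
      refine ⟨fun h => (Dvd.intro _ rfl).trans h, fun h => ?_⟩
      refine Nat.Coprime.mul_dvd_of_dvd_of_dvd (Nat.Coprime.pow_left _ ?_) h hd
      exact (Nat.coprime_self_sub_right hpp.one_le).2 (Nat.coprime_one_right p)
    have a := (key3 (padicValNat p (i + 1))).2 le_rfl
    have b := key3 (padicValNat p (i + 1) + 1)
    omega
  · intro hd
    have := key2 0
    rw [pow_zero, one_mul] at this
    have h : ¬ (0 + 1 ≤ x.valuation) := fun h => hd (this.1 h)
    omega
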